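/- arXiv:2305.08049 — 2 statements merged into one kernel-verified Lean document; each statement's English description precedes it below -/
import Mathlib

section
/- Let n ≥ 1 and let K be a nonempty finite (indexed) family of partial parameter vectors θ : Fin n → Option ℝ. For each dimension i, let N_i be the number of θ in K with θ_i ≠ none, and assume N_i > 0 for every i. Define the incomplete-data log-likelihood of a diagonal Gaussian with mean μ ∈ ℝⁿ and standard deviations σ ∈ (0,∞)ⁿ as L(μ, σ) = ∑_{θ ∈ K} ∑_{i : θ_i ≠ none} ℓ(val(θ_i); μ_i, σ_i), where ℓ(x; m, s) = −log(s · √(2π)) − (x − m)²/(2s²). Define μ̂_i = (1/N_i) · ∑_{θ ∈ K : θ_i ≠ none} val(θ_i) and σ̂_i² = (1/N_i) · ∑_{θ ∈ K : θ_i ≠ none} (val(θ_i) − μ̂_i)², and assume σ̂_i² > 0 for every i (i.e., in each dimension the observed values are not all equal). Then (μ̂, σ̂) maximizes L: for every μ ∈ ℝⁿ and every σ ∈ ℝⁿ with σ_i > 0 for all i, L(μ, σ) ≤ L(μ̂, σ̂). -/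
/-- Decomposition of the sum of squared deviations around an arbitrary point `a`,
in terms of the mean `m` and the variance `v`. -/
lemma sum_sub_sq_eq_card_mul_add {ι : Type*} (s : Finset ι) (x : ι → ℝ) (m v a : ℝ)
    (hm : (s.card : ℝ) * m = ∑ j ∈ s, x j)
    (hv : (s.card : ℝ) * v = ∑ j ∈ s, (x j - m) ^ 2) :
    ∑ j ∈ s, (x j - a) ^ 2 = s.card * (v + (m - a) ^ 2) := by
  have h : ∀ j ∈ s, (x j - a) ^ 2 =
      (x j - m) ^ 2 + (2 * (m - a) * x j + (a ^ 2 - m ^ 2)) := fun j _ => by ring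
  rw [Finset.sum_congr rfl h, Finset.sum_add_distrib, Finset.sum_add_distrib,
    ← Finset.mul_sum, ← hm, ← hv, Finset.sum_const, nsmul_eq_mul]
  ring

lemma log_sub_log_le_sq_div {a b : ℝ} (ha : 0 < a) (hb : 0 < b) :
    Real.log a - Real.log b ≤ a ^ 2 / (2 * b ^ 2) - 1 / 2 := by
  have h := Real.log_le_sub_one_of_pos (x := (a / b) ^ 2) (by positivity)
  rw [Real.log_pow, Real.log_div ha.ne' hb.ne', div_pow] at h
  have e : a ^ 2 / (2 * b ^ 2) = a ^ 2 / b ^ 2 / 2 := by field_simp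
  push_cast at h
  linarith

/-- The sample mean and sample standard deviation maximize the log-likelihood of a univariate
Gaussian. -/
lemma sum_gaussian_logDensity_le {ι : Type*} (s : Finset ι) (x : ι → ℝ) {m t a b : ℝ}
    (ht : 0 < t) (hb : 0 < b)
    (hm : (s.card : ℝ) * m = ∑ j ∈ s, x j)
    (hv : (s.card : ℝ) * t ^ 2 = ∑ j ∈ s, (x j - m) ^ 2) :
    ∑ j ∈ s, (-Real.log (b * Real.sqrt (2 * Real.pi)) - (x j - a) ^ 2 / (2 * b ^ 2)) ≤
      ∑ j ∈ s, (-Real.log (t * Real.sqrt (2 * Real.pi)) - (x j - m) ^ 2 / (2 * t ^ 2)) := by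
  have hc : Real.sqrt (2 * Real.pi) ≠ 0 := by positivity
  simp only [Finset.sum_sub_distrib, Finset.sum_const, nsmul_eq_mul, ← Finset.sum_div]
  rw [sum_sub_sq_eq_card_mul_add s x m (t ^ 2) a hm hv, ← hv,
    Real.log_mul hb.ne' hc, Real.log_mul ht.ne' hc, mul_div_assoc, mul_div_assoc,
    ← mul_sub, ← mul_sub]
  refine mul_le_mul_of_nonneg_left ?_ (Nat.cast_nonneg _)
  have hlog := log_sub_log_le_sq_div ht hb
  have hsq : 0 ≤ (m - a) ^ 2 / (2 * b ^ 2) := by positivity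
  have hhalf : t ^ 2 / (2 * t ^ 2) = 1 / 2 := by field_simp
  rw [add_div, hhalf]
  linarith


/-- **Lazy CE maximum-likelihood update (Theorem 4.1).**
Given a nonempty finite indexed family of partial parameter vectors
`θ : Fin m → Fin n → Option ℝ`, with each dimension observed at least once,
the per-dimension sample means `μ̂` and sample standard deviations `σ̂`
maximize the incomplete-data log-likelihood of a diagonal Gaussian. -/
theorem lazy_ce_gaussian_mle
    (n m : ℕ) (hn : 1 ≤ n) (hm : 1 ≤ m)
    (θ : Fin m → Fin n → Option ℝ)
    (Ncount : Fin n → ℕ)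
    (hNcount : ∀ i, Ncount i =
      (Finset.univ.filter (fun j : Fin m => (θ j i).isSome)).card)
    (hNpos : ∀ i, 0 < Ncount i)
    (ℓ : ℝ → ℝ → ℝ → ℝ)
    (hℓ : ∀ x μ σ, ℓ x μ σ =
      -Real.log (σ * Real.sqrt (2 * Real.pi)) - (x - μ) ^ 2 / (2 * σ ^ 2))
    (L : (Fin n → ℝ) → (Fin n → ℝ) → ℝ)
    (hL : ∀ μ σ, L μ σ = ∑ j : Fin m,
      ∑ i ∈ Finset.univ.filter (fun i : Fin n => (θ j i).isSome),
        ℓ ((θ j i).getD 0) (μ i) (σ i))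
    (μhat : Fin n → ℝ)
    (hμhat : ∀ i, μhat i = (1 / (Ncount i : ℝ)) *
      ∑ j ∈ Finset.univ.filter (fun j : Fin m => (θ j i).isSome), (θ j i).getD 0)
    (σhat : Fin n → ℝ)
    (hσhatpos : ∀ i, 0 < σhat i)
    (hσhat : ∀ i, (σhat i) ^ 2 = (1 / (Ncount i : ℝ)) *
      ∑ j ∈ Finset.univ.filter (fun j : Fin m => (θ j i).isSome),
        ((θ j i).getD 0 - μhat i) ^ 2) :
    ∀ (μ σ : Fin n → ℝ), (∀ i, 0 < σ i) → L μ σ ≤ L μhat σhat := by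
  intro μ σ hσ
  have hswap : ∀ μ σ : Fin n → ℝ, L μ σ = ∑ i : Fin n,
      ∑ j ∈ Finset.univ.filter (fun j : Fin m => (θ j i).isSome),
        ℓ ((θ j i).getD 0) (μ i) (σ i) := fun μ σ => by
    rw [hL]
    exact Finset.sum_comm' (by simp)
  rw [hswap, hswap]
  refine Finset.sum_le_sum fun i _ => ?_
  have hN : (Ncount i : ℝ) ≠ 0 := Nat.cast_ne_zero.mpr (hNpos i).ne'
  simp only [hℓ]
  refine sum_gaussian_logDensity_le _ (fun j => (θ j i).getD 0) (hσhatpos i) (hσ i) ?_ ?_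
  · rw [← hNcount i, hμhat i, one_div, mul_inv_cancel_left₀ hN]
  · rw [← hNcount i, hσhat i, one_div, mul_inv_cancel_left₀ hN]
end

section
/- Let n ≥ 1 and let K be a nonempty finite (indexed) family of partial parameter vectors θ : Fin n → Option ℝ. For each dimension i, let N_i be the number of θ in K with θ_i ≠ none, and assume N_i > 0 for every i. Define the incomplete-data log-likelihood L(μ, σ) = ∑_{θ ∈ K} ∑_{i : θ_i ≠ none} ℓ(val(θ_i); μ_i, σ_i), where ℓ(x; m, s) = −log(s · √(2π)) − (x − m)²/(2s²). Define μ̂_i = (1/N_i) · ∑_{θ ∈ K : θ_i ≠ none} val(θ_i) and σ̂_i² = (1/N_i) · ∑_{θ ∈ K : θ_i ≠ none} (val(θ_i) − μ̂_i)², and assume σ̂_i² > 0 for every i. Then the maximizer of L over ℝⁿ × (0,∞)ⁿ is unique: if (μ, σ) with σ_i > 0 for all i satisfies L(μ, σ) ≥ L(μ', σ') for all (μ', σ') with σ'_i > 0, then μ_i = μ̂_i and σ_i = σ̂_i for every i. -/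
/-- The average Gaussian log-likelihood of a sample with standard deviation `s`, as a function of the
offset `d` from the sample mean and of the scale `t`, is largest at `d = 0`, `t = s`. -/
lemma gaussian_profile_le {c s t : ℝ} (hc : 0 < c) (hs : 0 < s) (ht : 0 < t) (d : ℝ) :
    -Real.log (t * c) - (s ^ 2 + d ^ 2) / (2 * t ^ 2) ≤
      -Real.log (s * c) - (s ^ 2 + 0 ^ 2) / (2 * s ^ 2) := by
  have hlog : Real.log ((s / t) ^ 2) ≤ (s / t) ^ 2 - 1 :=
    Real.log_le_sub_one_of_pos (by positivity)
  rw [Real.log_pow, Real.log_div hs.ne' ht.ne'] at hlog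
  rw [Real.log_mul ht.ne' hc.ne', Real.log_mul hs.ne' hc.ne']
  have hd : 0 ≤ (d / t) ^ 2 := sq_nonneg _
  have h₁ : (s ^ 2 + d ^ 2) / (2 * t ^ 2) = ((s / t) ^ 2 + (d / t) ^ 2) / 2 := by field_simp
  have h₂ : (s ^ 2 + 0 ^ 2) / (2 * s ^ 2) = 1 / 2 := by field_simp; ring
  push_cast at hlog
  linarith

/-- The maximizer in `gaussian_profile_le` is unique. -/
lemma eq_of_gaussian_profile_eq {c s t d : ℝ} (hc : 0 < c) (hs : 0 < s) (ht : 0 < t)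
    (h : -Real.log (t * c) - (s ^ 2 + d ^ 2) / (2 * t ^ 2) =
      -Real.log (s * c) - (s ^ 2 + 0 ^ 2) / (2 * s ^ 2)) : d = 0 ∧ t = s := by
  have h₁ : (s ^ 2 + d ^ 2) / (2 * t ^ 2) = ((s / t) ^ 2 + (d / t) ^ 2) / 2 := by field_simp
  have h₂ : (s ^ 2 + 0 ^ 2) / (2 * s ^ 2) = 1 / 2 := by field_simp; ring
  rw [Real.log_mul ht.ne' hc.ne', Real.log_mul hs.ne' hc.ne', h₁, h₂] at h
  have hd : 0 ≤ (d / t) ^ 2 := sq_nonneg _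
  have hlog : Real.log ((s / t) ^ 2) = 2 * (Real.log s - Real.log t) := by
    rw [Real.log_pow, Real.log_div hs.ne' ht.ne']; norm_num
  have hst : (s / t) ^ 2 = 1 := by
    by_contra hne
    have := Real.log_lt_sub_one_of_pos (by positivity : 0 < (s / t) ^ 2) hne
    linarith
  have hd0 : (d / t) ^ 2 = 0 := by
    rw [hst, Real.log_one] at hlog
    linarith
  rw [pow_eq_one_iff_of_nonneg (div_pos hs ht).le two_ne_zero, div_eq_one_iff_eq ht.ne'] at hst
  refine ⟨?_, hst.symm⟩
  simpa [ht.ne'] using hd0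

/-- The Gaussian log-likelihood of a finite sample depends on the sample only through its size,
mean `a` and standard deviation `s`. -/
lemma sum_gaussian_log_density {ι : Type*} (A : Finset ι) (hA : 0 < A.card) (x : ι → ℝ)
    {a s : ℝ} (ha : a = (1 / (A.card : ℝ)) * ∑ j ∈ A, x j)
    (hs : s ^ 2 = (1 / (A.card : ℝ)) * ∑ j ∈ A, (x j - a) ^ 2) (c m t : ℝ) :
    ∑ j ∈ A, (-Real.log (t * c) - (x j - m) ^ 2 / (2 * t ^ 2)) =
      A.card * (-Real.log (t * c) - (s ^ 2 + (m - a) ^ 2) / (2 * t ^ 2)) := by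
  have hN : (A.card : ℝ) ≠ 0 := by positivity
  have hsum : ∑ j ∈ A, x j = A.card * a := by rw [ha]; field_simp
  have hsq : ∑ j ∈ A, (x j - a) ^ 2 = A.card * s ^ 2 := by rw [hs]; field_simp
  have key : ∑ j ∈ A, (x j - m) ^ 2 = A.card * (s ^ 2 + (m - a) ^ 2) := by
    have hexp : ∀ j ∈ A, (x j - m) ^ 2 =
        (x j - a) ^ 2 + 2 * (a - m) * x j + (m ^ 2 - a ^ 2) := fun j _ => by ring
    rw [Finset.sum_congr rfl hexp, Finset.sum_add_distrib, Finset.sum_add_distrib,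
      ← Finset.mul_sum, hsum, hsq, Finset.sum_const, nsmul_eq_mul]
    ring
  rw [Finset.sum_sub_distrib, Finset.sum_const, nsmul_eq_mul, ← Finset.sum_div, key]
  ring


/-- **Uniqueness of the lazy CE maximum-likelihood update.**
Under the hypotheses of Theorem 4.1, any maximizer `(μ, σ)` of the
incomplete-data log-likelihood (with all `σ i > 0`) must coincide with the
per-dimension sample means `μ̂` and sample standard deviations `σ̂`. -/
theorem lazy_ce_gaussian_mle_unique
    (n m : ℕ) (hn : 1 ≤ n) (hm : 1 ≤ m)
    (θ : Fin m → Fin n → Option ℝ)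
    (Ncount : Fin n → ℕ)
    (hNcount : ∀ i, Ncount i =
      (Finset.univ.filter (fun j : Fin m => (θ j i).isSome)).card)
    (hNpos : ∀ i, 0 < Ncount i)
    (ℓ : ℝ → ℝ → ℝ → ℝ)
    (hℓ : ∀ x μ σ, ℓ x μ σ =
      -Real.log (σ * Real.sqrt (2 * Real.pi)) - (x - μ) ^ 2 / (2 * σ ^ 2))
    (L : (Fin n → ℝ) → (Fin n → ℝ) → ℝ)
    (hL : ∀ μ σ, L μ σ = ∑ j : Fin m,
      ∑ i ∈ Finset.univ.filter (fun i : Fin n => (θ j i).isSome),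
        ℓ ((θ j i).getD 0) (μ i) (σ i))
    (μhat : Fin n → ℝ)
    (hμhat : ∀ i, μhat i = (1 / (Ncount i : ℝ)) *
      ∑ j ∈ Finset.univ.filter (fun j : Fin m => (θ j i).isSome), (θ j i).getD 0)
    (σhat : Fin n → ℝ)
    (hσhatpos : ∀ i, 0 < σhat i)
    (hσhat : ∀ i, (σhat i) ^ 2 = (1 / (Ncount i : ℝ)) *
      ∑ j ∈ Finset.univ.filter (fun j : Fin m => (θ j i).isSome),
        ((θ j i).getD 0 - μhat i) ^ 2)
    (μ σ : Fin n → ℝ) (hσpos : ∀ i, 0 < σ i)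
    (hmax : ∀ (μ' σ' : Fin n → ℝ), (∀ i, 0 < σ' i) → L μ' σ' ≤ L μ σ) :
    ∀ i, μ i = μhat i ∧ σ i = σhat i := by
  have hc : 0 < Real.sqrt (2 * Real.pi) := by positivity
  have hLsum : ∀ μ' σ', L μ' σ' = ∑ i, (Ncount i : ℝ) *
      (-Real.log (σ' i * Real.sqrt (2 * Real.pi)) -
        (σhat i ^ 2 + (μ' i - μhat i) ^ 2) / (2 * σ' i ^ 2)) := by
    intro μ' σ'
    rw [hL]
    simp_rw [Finset.sum_filter]
    rw [Finset.sum_comm]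
    refine Finset.sum_congr rfl fun i _ => ?_
    rw [← Finset.sum_filter, hNcount i]
    simp_rw [hℓ]
    exact sum_gaussian_log_density _ (hNcount i ▸ hNpos i) (fun j => (θ j i).getD 0)
      (hNcount i ▸ hμhat i) (hNcount i ▸ hσhat i) _ _ _
  have hle := hmax μhat σhat hσhatpos
  simp only [hLsum, sub_self] at hle
  have hterm : ∀ i ∈ Finset.univ, _ := fun i (_ : i ∈ Finset.univ) =>
    mul_le_mul_of_nonneg_left
      (gaussian_profile_le hc (hσhatpos i) (hσpos i) (μ i - μhat i)) (Nat.cast_nonneg (Ncount i))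
  have heq := (Finset.sum_eq_sum_iff_of_le hterm).1 (le_antisymm (Finset.sum_le_sum hterm) hle)
  intro i
  have hN : (Ncount i : ℝ) ≠ 0 := Nat.cast_ne_zero.2 (hNpos i).ne'
  obtain ⟨hd, ht⟩ := eq_of_gaussian_profile_eq hc (hσhatpos i) (hσpos i)
    (mul_left_cancel₀ hN (heq i (Finset.mem_univ i)))
  exact ⟨sub_eq_zero.1 hd, ht⟩
end
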